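/- arXiv:2404.00765 — 4 statements merged into one kernel-verified Lean document; each statement's English description precedes it below -/
import Mathlib

section
/- Let φ : ℝⁿ → ℝ be concave, let R ∈ ℝⁿ, and let γ ∈ ℝ. Then the set T = {z ∈ ℝⁿ | ∃ u, v ∈ ℝⁿ with u ≥ 0, v ≥ 0, z = v − u, and φ(R + γu − v) ≥ φ(R)} is a convex subset of ℝⁿ. -/
/-- The set of trades accepted by a CFMM with a concave trading function is convex. -/
theorem stmt5 (n : ℕ) (φ : (Fin n → ℝ) → ℝ)
    (hφ : ConcaveOn ℝ Set.univ φ) (R : Fin n → ℝ) (γ : ℝ) :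
    Convex ℝ {z : Fin n → ℝ | ∃ u v : Fin n → ℝ,
      0 ≤ u ∧ 0 ≤ v ∧ z = v - u ∧ φ R ≤ φ (R + γ • u - v)} := by
  rintro _ ⟨u₁, v₁, hu₁, hv₁, rfl, h₁⟩ _ ⟨u₂, v₂, hu₂, hv₂, rfl, h₂⟩ a b ha hb hab
  refine ⟨a • u₁ + b • u₂, a • v₁ + b • v₂,
    add_nonneg (smul_nonneg ha hu₁) (smul_nonneg hb hu₂),
    add_nonneg (smul_nonneg ha hv₁) (smul_nonneg hb hv₂), by module, ?_⟩
  have hR : R + γ • (a • u₁ + b • u₂) - (a • v₁ + b • v₂)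
      = a • (R + γ • u₁ - v₁) + b • (R + γ • u₂ - v₂) := by
    obtain rfl : b = 1 - a := by linarith
    module
  rw [hR]
  exact (hφ.convex_ge (φ R) ⟨trivial, h₁⟩ ⟨trivial, h₂⟩ ha hb hab).2
end

section
/- (Saturation of a bounded edge.) Let h : ℝ → ℝ be concave and let w_max ∈ ℝ satisfy h(w_max) ≥ h(w) for all w ∈ ℝ. Let η₁ ≥ 0 and η₂ ≥ 0, and suppose h has a left derivative d⁻ at w_max (the derivative at w_max of h restricted to (−∞, w_max]) with η₁ ≤ η₂ d⁻. Then w_max is a global maximizer of g(w) = −η₁ w + η₂ h(w): for every w ∈ ℝ, −η₁ w + η₂ h(w) ≤ −η₁ w_max + η₂ h(w_max). -/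
/-- Saturation of a bounded edge: if `h` is concave with global maximizer `w_max`,
`η₁, η₂ ≥ 0`, and `η₁ ≤ η₂ h⁻(w_max)`, then `w_max` maximizes `-η₁ w + η₂ h(w)`. -/
theorem stmt9 (h : ℝ → ℝ) (hconc : ConcaveOn ℝ Set.univ h)
    (wmax : ℝ) (hwmax : ∀ w : ℝ, h w ≤ h wmax)
    (η₁ η₂ : ℝ) (hη₁ : 0 ≤ η₁) (hη₂ : 0 ≤ η₂) (dm : ℝ)
    (hdm : HasDerivWithinAt h dm (Set.Iic wmax) wmax)
    (hprice : η₁ ≤ η₂ * dm) :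
    ∀ w : ℝ, -η₁ * w + η₂ * h w ≤ -η₁ * wmax + η₂ * h wmax := by
  intro w
  rcases lt_or_ge w wmax with hw | hw
  · have hslope : dm ≤ slope h w wmax :=
      hconc.le_slope_of_hasDerivWithinAt_Iio trivial trivial hw (hdm.mono Set.Iio_subset_Iic_self)
    rw [slope_def_field, le_div_iff₀ (sub_pos.2 hw)] at hslope
    have hgain := mul_le_mul_of_nonneg_left hslope hη₂
    have hcost := mul_le_mul_of_nonneg_right hprice (sub_pos.2 hw).le
    linarith
  · have hgain := mul_le_mul_of_nonneg_left (hwmax w) hη₂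
    have hcost := mul_le_mul_of_nonneg_left hw hη₁
    linarith
end

section
/- (Optimality certificate from dual prices.) Let U : ℝⁿ → ℝ, and for i = 1, …, m let V_i : ℝ^{n_i} → ℝ, T_i ⊆ ℝ^{n_i}, and A_i ∈ ℝ^{n×n_i}. Let ν ∈ ℝⁿ and η_i ∈ ℝ^{n_i}, and suppose there exist y* ∈ ℝⁿ and x_i* ∈ T_i such that: (a) U(y) − νᵀy ≤ U(y*) − νᵀy* for all y ∈ ℝⁿ; (b) V_i(x) − (η_i − A_iᵀν)ᵀx ≤ V_i(x_i*) − (η_i − A_iᵀν)ᵀx_i* for all x ∈ ℝ^{n_i} and all i; (c) η_iᵀx ≤ η_iᵀx_i* for all x ∈ T_i and all i; and (d) y* = Σ_{i=1}^m A_i x_i*. Then (y*, {x_i*}) is optimal for the convex flow problem: for every y ∈ ℝⁿ and x_i ∈ T_i with y = Σ_{i=1}^m A_i x_i, one has U(y) + Σ_{i=1}^m V_i(x_i) ≤ U(y*) + Σ_{i=1}^m V_i(x_i*). -/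
open Matrix

/-- Optimality certificate from dual prices for the convex flow problem. -/
theorem stmt16 (n m : ℕ) (k : Fin m → ℕ)
    (U : (Fin n → ℝ) → ℝ) (V : ∀ i : Fin m, (Fin (k i) → ℝ) → ℝ)
    (T : ∀ i : Fin m, Set (Fin (k i) → ℝ))
    (A : ∀ i : Fin m, Matrix (Fin n) (Fin (k i)) ℝ)
    (ν : Fin n → ℝ) (η : ∀ i : Fin m, Fin (k i) → ℝ)
    (ystar : Fin n → ℝ) (xstar : ∀ i : Fin m, Fin (k i) → ℝ)
    (hxstar : ∀ i, xstar i ∈ T i)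
    (ha : ∀ y : Fin n → ℝ, U y - ν ⬝ᵥ y ≤ U ystar - ν ⬝ᵥ ystar)
    (hb : ∀ (i : Fin m) (x : Fin (k i) → ℝ),
      V i x - (η i - (A i)ᵀ.mulVec ν) ⬝ᵥ x ≤
        V i (xstar i) - (η i - (A i)ᵀ.mulVec ν) ⬝ᵥ xstar i)
    (hc : ∀ (i : Fin m), ∀ x ∈ T i, η i ⬝ᵥ x ≤ η i ⬝ᵥ xstar i)
    (hd : ystar = ∑ i, (A i).mulVec (xstar i)) :
    ∀ (y : Fin n → ℝ) (x : ∀ i : Fin m, Fin (k i) → ℝ), (∀ i, x i ∈ T i) →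
      y = ∑ i, (A i).mulVec (x i) →
      U y + ∑ i, V i (x i) ≤ U ystar + ∑ i, V i (xstar i) := by
  intro y x hx hy
  have price (z : ∀ i : Fin m, Fin (k i) → ℝ) :
      ν ⬝ᵥ ∑ i, (A i).mulVec (z i) = ∑ i, (A i)ᵀ.mulVec ν ⬝ᵥ z i := by
    simp only [dotProduct_sum, dotProduct_mulVec, mulVec_transpose]
  have edge (i : Fin m) : V i (x i) + (A i)ᵀ.mulVec ν ⬝ᵥ x i ≤
      V i (xstar i) + (A i)ᵀ.mulVec ν ⬝ᵥ xstar i := by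
    have h₁ := hb i (x i)
    have h₂ := hc i (x i) (hx i)
    simp only [sub_dotProduct] at h₁
    linarith
  have total := Finset.sum_le_sum fun i (_ : i ∈ Finset.univ) => edge i
  simp only [Finset.sum_add_distrib] at total
  rw [← price x, ← price xstar, ← hy, ← hd] at total
  linarith [ha y]
end

section
/- Let ℓ(w) = 16(log(1 + exp(w/4)) − log 2) − 2w and h(w) = w − ℓ(w). Let b > 0 and let η₁, η₂ > 0 satisfy η₁ < 3η₂. Define w* = min{ max{ 4 · log((3η₂ − η₁)/(η₂ + η₁)), 0 }, b}. Then w* maximizes −η₁w + η₂h(w) over the interval [0, b]: for every w ∈ [0, b], −η₁w + η₂h(w) ≤ −η₁w* + η₂h(w*). -/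
/-- The softplus function lies above its tangent lines. -/
lemma softplus_tangent_le (u v : ℝ) :
    Real.log (1 + Real.exp v) + Real.exp v / (1 + Real.exp v) * (u - v) ≤
      Real.log (1 + Real.exp u) := by
  have hv := Real.exp_pos v
  have hu := Real.exp_pos u
  have hs : 1 / (1 + Real.exp v) + Real.exp v / (1 + Real.exp v) = 1 := by field_simp
  have key := convexOn_exp.2 (Set.mem_univ 0) (Set.mem_univ (u - v))
    (by positivity : 0 ≤ 1 / (1 + Real.exp v))
    (by positivity : 0 ≤ Real.exp v / (1 + Real.exp v)) hs
  simp only [smul_eq_mul, mul_zero, zero_add, Real.exp_zero, mul_one] at key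
  have hquot : 1 / (1 + Real.exp v) + Real.exp v / (1 + Real.exp v) * Real.exp (u - v) =
      (1 + Real.exp u) / (1 + Real.exp v) := by
    rw [Real.exp_sub]
    field_simp
  rw [hquot, ← Real.le_log_iff_exp_le (by positivity),
    Real.log_div (by positivity) (by positivity)] at key
  linarith

/-- Variational inequality for the clamp `min (max a 0) b` of `a` to `[0, b]`, with the
residual measured through the exponential. -/
lemma exp_sub_exp_clamp_mul_nonpos {a b w : ℝ} (hb : 0 < b) (hw : w ∈ Set.Icc 0 b) :
    (Real.exp (a / 4) - Real.exp (min (max a 0) b / 4)) * (w - min (max a 0) b) ≤ 0 := by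
  obtain ⟨hw0, hwb⟩ := hw
  rcases le_total a 0 with ha | ha
  · rw [max_eq_right ha, min_eq_left hb.le]
    exact mul_nonpos_of_nonpos_of_nonneg
      (sub_nonpos.2 (Real.exp_le_exp.2 (by linarith))) (by linarith)
  · rw [max_eq_left ha]
    rcases le_total a b with hab | hab
    · simp [min_eq_left hab]
    · rw [min_eq_right hab]
      exact mul_nonpos_of_nonneg_of_nonpos
        (sub_nonneg.2 (Real.exp_le_exp.2 (by linarith))) (by linarith)

/-- Closed-form solution of the arbitrage subproblem for the optimal power flow
transmission line with loss `ℓ(w) = 16(log(1 + exp(w/4)) − log 2) − 2w`. -/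
theorem stmt17 (b η₁ η₂ : ℝ) (hb : 0 < b) (h1 : 0 < η₁) (h2 : 0 < η₂)
    (h3 : η₁ < 3 * η₂) :
    let ℓ : ℝ → ℝ := fun w =>
      16 * (Real.log (1 + Real.exp (w / 4)) - Real.log 2) - 2 * w
    let h : ℝ → ℝ := fun w => w - ℓ w
    let wstar : ℝ :=
      min (max (4 * Real.log ((3 * η₂ - η₁) / (η₂ + η₁))) 0) b
    ∀ w ∈ Set.Icc (0 : ℝ) b,
      -η₁ * w + η₂ * h w ≤ -η₁ * wstar + η₂ * h wstar := by
  intro ℓ h wstar w hw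
  have hvar : (Real.exp (4 * Real.log ((3 * η₂ - η₁) / (η₂ + η₁)) / 4) -
      Real.exp (wstar / 4)) * (w - wstar) ≤ 0 := exp_sub_exp_clamp_mul_nonpos hb hw
  rw [mul_div_cancel_left₀ _ (by norm_num : (4 : ℝ) ≠ 0),
    Real.exp_log (div_pos (by linarith) (by linarith))] at hvar
  have htan := mul_le_mul_of_nonneg_left (softplus_tangent_le (w / 4) (wstar / 4))
    (by positivity : 0 ≤ 16 * η₂)
  simp only [h, ℓ]
  clear_value wstar
  have hE := Real.exp_pos (wstar / 4)
  set E := Real.exp (wstar / 4)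
  have hslope : (3 * η₂ - η₁ - 4 * η₂ * (E / (1 + E))) * (w - wstar) =
      (η₂ + η₁) / (1 + E) * (((3 * η₂ - η₁) / (η₂ + η₁) - E) * (w - wstar)) := by
    field_simp
    ring
  have hle : (3 * η₂ - η₁ - 4 * η₂ * (E / (1 + E))) * (w - wstar) ≤ 0 :=
    hslope ▸ mul_nonpos_of_nonneg_of_nonpos (by positivity) hvar
  linarith
end
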